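/- Let q ≥ 1 with Hölder conjugate p (1/p + 1/q = 1, with p = ∞ when q = 1), let φ ∈ ℝ^d with φ ≠ 0, let λ₂ ∈ ℝ, r ∈ ℝ^d, and λ₁ ≥ 0. (i) If λ₁ > ‖φ‖_p², then sup_{u ∈ ℝ^d} [ ⟨φ,u⟩² − λ₁‖u − r‖_q² − λ₂⟨φ,u⟩ ] = ⟨φ,r⟩² − λ₂⟨φ,r⟩ + (2⟨φ,r⟩ − λ₂)² ‖φ‖_p² / (4(λ₁ − ‖φ‖_p²)). (ii) If λ₁ < ‖φ‖_p², then sup_{u ∈ ℝ^d} [ ⟨φ,u⟩² − λ₁‖u − r‖_q² − λ₂⟨φ,u⟩ ] = +∞. -/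

import Mathlib

open MeasureTheory ENNReal NNReal Filter Topology

noncomputable section

/-- The `l_p` norm on `ℝ^d`, for an extended exponent `p` (sup-norm when `p = ∞`). -/
def lpNorm {d : ℕ} (p : ℝ≥0∞) (x : Fin d → ℝ) : ℝ :=
  if p = ∞ then ⨆ i, |x i| else (∑ i, |x i| ^ p.toReal) ^ (1 / p.toReal)

/-- `p ∈ [1,∞]` is the Hölder conjugate of `q ∈ [1,∞)`: `1/p + 1/q = 1`,
with `p = ∞` when `q = 1`. -/
def HolderConjugate (q : ℝ) (p : ℝ≥0∞) : Prop :=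
  (q = 1 ∧ p = ∞) ∨ (1 < q ∧ p ≠ ∞ ∧ 1 / p.toReal + 1 / q = 1)

/-- The optimal transport discrepancy between two Borel probability measures on `ℝ^d`
associated with a cost function `c`. -/
def Dc {d : ℕ} (c : (Fin d → ℝ) → (Fin d → ℝ) → ℝ≥0∞)
    (P Q : Measure (Fin d → ℝ)) : ℝ≥0∞ :=
  ⨅ (π : Measure ((Fin d → ℝ) × (Fin d → ℝ))) (_ : IsProbabilityMeasure π)
    (_ : π.map Prod.fst = P) (_ : π.map Prod.snd = Q), ∫⁻ x, c x.1 x.2 ∂π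

/-- The quadratic `l_q` transport cost `c(u,w) = ‖u - w‖_q²`. -/
def costQ {d : ℕ} (q : ℝ) (u w : Fin d → ℝ) : ℝ≥0∞ :=
  ENNReal.ofReal (lpNorm (ENNReal.ofReal q) (u - w) ^ 2)

/-- The empirical measure `P_n = (1/n) ∑_{i=1}^n δ_{R_i}`. -/
def empMeasure {d n : ℕ} (R : Fin n → Fin d → ℝ) : Measure (Fin d → ℝ) :=
  (n : ℝ≥0∞)⁻¹ • ∑ i : Fin n, Measure.dirac (R i)

/-- Weak convergence of a sequence of measures, expressed via integration of
bounded continuous functions. -/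
def WeakConv {E : Type*} [TopologicalSpace E] [MeasurableSpace E]
    (μs : ℕ → Measure E) (ν : Measure E) : Prop :=
  ∀ f : BoundedContinuousFunction E ℝ,
    Tendsto (fun n => ∫ x, f x ∂(μs n)) atTop (𝓝 (∫ x, f x ∂ν))

section

variable {d : ℕ}

lemma lpNorm_nonneg (p : ℝ≥0∞) (x : Fin d → ℝ) : 0 ≤ lpNorm p x := by
  unfold _root_.lpNorm
  split_ifs
  · exact Real.iSup_nonneg fun i => abs_nonneg _
  · positivity

lemma lpNorm_ofReal {q : ℝ} (hq : 1 ≤ q) (x : Fin d → ℝ) :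
    lpNorm (ENNReal.ofReal q) x = (∑ i, |x i| ^ q) ^ (1 / q) := by
  rw [_root_.lpNorm, if_neg ENNReal.ofReal_ne_top, ENNReal.toReal_ofReal (by linarith)]

lemma lpNorm_ofReal_smul {q : ℝ} (hq : 1 ≤ q) (t : ℝ) (x : Fin d → ℝ) :
    lpNorm (ENNReal.ofReal q) (t • x) = |t| * lpNorm (ENNReal.ofReal q) x := by
  rw [lpNorm_ofReal hq, lpNorm_ofReal hq]
  have h : ∀ i, |(t • x) i| ^ q = |t| ^ q * |x i| ^ q := fun i => by
    rw [Pi.smul_apply, smul_eq_mul, abs_mul, Real.mul_rpow (abs_nonneg _) (abs_nonneg _)]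
  simp_rw [h]
  rw [← Finset.mul_sum, Real.mul_rpow (by positivity) (by positivity), one_div,
    Real.rpow_rpow_inv (abs_nonneg _) (by linarith)]

lemma HolderConjugate.real_holderConjugate {q : ℝ} {p : ℝ≥0∞} (hq : 1 < q)
    (h : 1 / p.toReal + 1 / q = 1) : p.toReal.HolderConjugate q := by
  refine (Real.holderConjugate_iff.mpr ⟨hq, ?_⟩).symm
  rw [← h]
  ring

/-- Hölder's inequality for `lpNorm`. -/
lemma HolderConjugate.abs_sum_mul_le {q : ℝ} {p : ℝ≥0∞} (hpq : HolderConjugate q p)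
    (x y : Fin d → ℝ) :
    |∑ j, x j * y j| ≤ lpNorm p x * lpNorm (ENNReal.ofReal q) y := by
  refine (Finset.abs_sum_le_sum_abs _ _).trans ?_
  simp_rw [abs_mul]
  rcases hpq with ⟨rfl, rfl⟩ | ⟨hq, hp, h⟩
  · rw [lpNorm_ofReal le_rfl, _root_.lpNorm, if_pos rfl]
    simp only [Real.rpow_one, div_one]
    rw [Finset.mul_sum]
    gcongr with i
    exact le_ciSup (f := fun i => |x i|) (Set.finite_range _).bddAbove i
  · rw [lpNorm_ofReal hq.le, _root_.lpNorm, if_neg hp]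
    simpa using Real.inner_le_Lp_mul_Lq Finset.univ (fun i => |x i|) (fun i => |y i|)
      (HolderConjugate.real_holderConjugate hq h)

/-- The supremum defining the dual norm is attained. -/
lemma HolderConjugate.exists_sum_mul_eq {q : ℝ} {p : ℝ≥0∞} (hpq : HolderConjugate q p)
    {x : Fin d → ℝ} (hx : x ≠ 0) :
    ∃ v : Fin d → ℝ, ∑ j, x j * v j = lpNorm p x ∧ lpNorm (ENNReal.ofReal q) v ≤ 1 := by
  have hsign : ∀ a : ℝ, |(SignType.sign a : ℝ)| ≤ 1 := fun a => by
    rcases lt_trichotomy a 0 with h | rfl | h <;> simp [*]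
  rcases hpq with ⟨rfl, rfl⟩ | ⟨hq, hp, h⟩
  · obtain ⟨k, -⟩ := Function.ne_iff.mp hx
    have : Nonempty (Fin d) := ⟨k⟩
    obtain ⟨i, hi⟩ := exists_eq_ciSup_of_finite (f := fun i => |x i|)
    refine ⟨Pi.single i (SignType.sign (x i) : ℝ), ?_, ?_⟩
    · rw [_root_.lpNorm, if_pos rfl, ← hi]
      simp [Pi.single_apply, self_mul_sign]
    · rw [lpNorm_ofReal le_rfl]
      simp only [Real.rpow_one, div_one]
      rw [Finset.sum_eq_single i (fun j _ hj => by simp [hj]) (by simp)]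
      simpa using hsign (x i)
  · have hc := HolderConjugate.real_holderConjugate hq h
    obtain ⟨g, hg, hgx⟩ := (NNReal.isGreatest_Lp Finset.univ (fun i => ‖x i‖₊) hc).1
    refine ⟨fun i => SignType.sign (x i) * g i, ?_, ?_⟩
    · rw [_root_.lpNorm, if_neg hp]
      have := congrArg NNReal.toReal hgx
      simp only [NNReal.coe_sum, NNReal.coe_mul, coe_nnnorm, Real.norm_eq_abs, NNReal.coe_rpow]
        at this
      rw [← this]
      exact Finset.sum_congr rfl fun i _ => by rw [← mul_assoc, self_mul_sign]
    · rw [lpNorm_ofReal hq.le]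
      refine Real.rpow_le_one (by positivity) ?_ (by positivity)
      have hg' : ∑ i, (g i : ℝ) ^ q ≤ 1 := by exact_mod_cast hg
      refine le_trans (Finset.sum_le_sum fun i _ => ?_) hg'
      refine Real.rpow_le_rpow (abs_nonneg _) ?_ (by linarith)
      rw [abs_mul, NNReal.abs_eq]
      exact mul_le_of_le_one_left (g i).2 (hsign _)

end

/-- The inner supremum in the dual of the worst-case second-moment
problem with quadratic `l_q` cost: finite explicit value when `λ₁ > ‖φ‖_p²`, and `+∞`
when `λ₁ < ‖φ‖_p²`. -/
theorem stmt6 {d : ℕ} (q : ℝ) (hq : 1 ≤ q) (p : ℝ≥0∞) (hpq : HolderConjugate q p)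
    (φ : Fin d → ℝ) (hφ : φ ≠ 0) (lam2 : ℝ) (r : Fin d → ℝ) (lam1 : ℝ) (hlam1 : 0 ≤ lam1) :
    (lpNorm p φ ^ 2 < lam1 →
      (⨆ u : Fin d → ℝ,
          (((∑ j, φ j * u j) ^ 2 - lam1 * lpNorm (ENNReal.ofReal q) (u - r) ^ 2 -
              lam2 * ∑ j, φ j * u j : ℝ) : EReal)) =
        (((∑ j, φ j * r j) ^ 2 - lam2 * ∑ j, φ j * r j +
            (2 * (∑ j, φ j * r j) - lam2) ^ 2 * lpNorm p φ ^ 2 /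
              (4 * (lam1 - lpNorm p φ ^ 2)) : ℝ) : EReal)) ∧
    (lam1 < lpNorm p φ ^ 2 →
      (⨆ u : Fin d → ℝ,
          (((∑ j, φ j * u j) ^ 2 - lam1 * lpNorm (ENNReal.ofReal q) (u - r) ^ 2 -
              lam2 * ∑ j, φ j * u j : ℝ) : EReal)) = ⊤) := by
  set N := lpNorm p φ with hN
  set a := ∑ j, φ j * r j with ha
  obtain ⟨v, hv, hv1⟩ := hpq.exists_sum_mul_eq hφ
  have hvsq : lpNorm (ENNReal.ofReal q) v ^ 2 ≤ 1 := pow_le_one₀ (lpNorm_nonneg _ _) hv1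
  have hray : ∀ t : ℝ, a ^ 2 - lam2 * a + ((2 * a - lam2) * N * t - (lam1 - N ^ 2) * t ^ 2) ≤
      (∑ j, φ j * (r + t • v) j) ^ 2 -
        lam1 * lpNorm (ENNReal.ofReal q) (r + t • v - r) ^ 2 -
        lam2 * ∑ j, φ j * (r + t • v) j := fun t => by
    have hsum : ∑ j, φ j * (r + t • v) j = a + t * N := by
      rw [hN, ← hv, ha, Finset.mul_sum, ← Finset.sum_add_distrib]
      exact Finset.sum_congr rfl fun j _ => by simp; ring
    rw [hsum, add_sub_cancel_left, lpNorm_ofReal_smul hq, mul_pow, sq_abs]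
    nlinarith [mul_le_mul_of_nonneg_left hvsq (mul_nonneg hlam1 (sq_nonneg t))]
  constructor
  · intro hlt
    have hD : 0 < lam1 - N ^ 2 := sub_pos.mpr hlt
    apply le_antisymm
    · refine iSup_le fun u => EReal.coe_le_coe_iff.mpr ?_
      have hu : ∑ j, φ j * u j = a + ∑ j, φ j * (u - r) j := by
        rw [ha, ← Finset.sum_add_distrib]
        exact Finset.sum_congr rfl fun j _ => by simp; ring
      have hs := hpq.abs_sum_mul_le φ (u - r)
      rw [← hN] at hs
      rw [hu]
      generalize ∑ j, φ j * (u - r) j = s at hs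
      generalize lpNorm (ENNReal.ofReal q) (u - r) = n at hs
      have hs2 : s ^ 2 ≤ N ^ 2 * n ^ 2 := by
        rw [← sq_abs, ← mul_pow]
        exact pow_le_pow_left₀ (abs_nonneg s) hs 2
      have hcs : (2 * a - lam2) * s ≤ |2 * a - lam2| * (N * n) :=
        (le_abs_self _).trans (by rw [abs_mul]; gcongr)
      have hmax : |2 * a - lam2| * (N * n) - (lam1 - N ^ 2) * n ^ 2 ≤
          (2 * a - lam2) ^ 2 * N ^ 2 / (4 * (lam1 - N ^ 2)) := by
        rw [le_div_iff₀ (by positivity), ← sq_abs (2 * a - lam2)]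
        nlinarith [sq_nonneg (|2 * a - lam2| * N - 2 * (lam1 - N ^ 2) * n)]
      linarith
    · set t := (2 * a - lam2) * N / (2 * (lam1 - N ^ 2)) with ht
      refine le_iSup_of_le (r + t • v) (EReal.coe_le_coe_iff.mpr ((hray t).trans' (le_of_eq ?_)))
      rw [ht]
      field_simp
      ring
  · intro hlt
    have hD : 0 < N ^ 2 - lam1 := sub_pos.mpr hlt
    refine EReal.eq_top_iff_forall_lt _ |>.mpr fun M => ?_
    have hlim : Tendsto (fun t : ℝ => t * ((N ^ 2 - lam1) * t + (2 * a - lam2) * N)) atTop atTop :=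
      tendsto_id.atTop_mul_atTop₀
        (tendsto_atTop_add_const_right _ _ (tendsto_id.const_mul_atTop hD))
    obtain ⟨t, ht⟩ := (hlim.eventually_gt_atTop (M - (a ^ 2 - lam2 * a))).exists
    refine lt_of_lt_of_le ?_ (le_iSup_of_le (r + t • v) (EReal.coe_le_coe_iff.mpr (hray t)))
    exact EReal.coe_lt_coe_iff.mpr (by linarith)
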